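/- Let k ∈ ℤ^n with k ≥ 0 and λ = B_1|…|B_l ∈ P_{⊞^k}. Then for every r ∈ {1,…,l} the multiset B̄_r is a set (every element has multiplicity at most 1), and λ̄ = B̄_1|…|B̄_l is a proper ordered partition of the multiset [k]. -/

import Mathlib

section Core

variable {A : Type*} [DecidableEq A] [Fintype A]

/-- A cube of the standard `A`-cube: `none` means `*`, `some true` means `1`,
`some false` means `0`. -/
abbrev Cube (A : Type*) := A → Option Bool

/-- The cube `c(O, S, rest)` with value `1` on `O`, `*` on `S` and `0` elsewhere. -/
def cubeOn (O S : Finset A) : Cube A := fun a =>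
  if a ∈ S then none else if a ∈ O then some true else some false

/-- An `A`-cubical complex: a set of cubes closed under the face maps, i.e. under
replacing any occurrence of `*` by `0` or `1`. -/
def IsComplex (K : Set (Cube A)) : Prop :=
  ∀ c ∈ K, ∀ a : A, c a = none → ∀ ε : Bool, Function.update c a (some ε) ∈ K

/-- Union of the blocks of a list of finsets. -/
def blocksUnion (L : List (Finset A)) : Finset A := L.foldr (· ∪ ·) ∅

/-- `L` is an ordered partition of `S`: a sequence of nonempty pairwise disjoint
subsets whose union is `S`. -/
def IsOPart (S : Finset A) (L : List (Finset A)) : Prop :=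
  (∀ B ∈ L, B.Nonempty) ∧
    List.Pairwise (fun B C : Finset A => Disjoint B C) L ∧ blocksUnion L = S

/-- The set `P_K` of ordered partitions `L = B₁|…|B_l` of `S` such that each cube
`c((O ∪ B₁∪…∪B_{i-1}), B_i, rest)` belongs to `K`.  Here `O` records the part of the
ambient set on which the cubes take the fixed value `1` (used for the restrictions
`K|_B^ε`); for the full complex take `O = ∅`, `S = univ`. -/
def PK (K : Set (Cube A)) (O S : Finset A) : Set (List (Finset A)) :=
  {L | IsOPart S L ∧ ∀ (i : ℕ) (h : i < L.length),
    cubeOn (O ∪ blocksUnion (L.take i)) (L[i]'h) ∈ K}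

/-- `x` refines `y`: the blocks of `y` are obtained by uniting consecutive blocks of `x`. -/
def Refines (x y : List (Finset A)) : Prop :=
  ∃ LL : List (List (Finset A)), (∀ l ∈ LL, l ≠ []) ∧
    x = LL.flatten ∧ y = LL.map blocksUnion

/-- Dimension of an ordered partition: `Σ (#Bᵢ - 1)`. -/
def pdim (L : List (Finset A)) : ℕ := (L.map fun B => B.card - 1).sum

/-- The facet relation on ordered partitions. -/
def PFacet (x y : List (Finset A)) : Prop :=
  Refines x y ∧ x ≠ y ∧ pdim y = pdim x + 1

/-- A cycle of a discrete vector field on a poset of ordered partitions. -/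
def PCycle (V : Set (List (Finset A) × List (Finset A))) (k : ℕ)
    (a : Fin (k + 1) → List (Finset A)) (b : Fin k → List (Finset A)) : Prop :=
  0 < k ∧ a 0 = a (Fin.last k) ∧
    ∀ i : Fin k, (a i.castSucc, b i) ∈ V ∧ (a i.succ, b i) ∉ V ∧ PFacet (a i.succ) (b i)

/-- A discrete vector field on ordered partitions is a gradient field if it has no cycle. -/
def PGradient (V : Set (List (Finset A) × List (Finset A))) : Prop :=
  ∀ k a b, ¬ PCycle V k a b

/-- Critical cells of a discrete vector field `V` on the set of cells `S`. -/
def CritOn (S : Set (List (Finset A)))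
    (V : Set (List (Finset A) × List (Finset A))) : Set (List (Finset A)) :=
  {x | x ∈ S ∧ ∀ p ∈ V, p.1 ≠ x ∧ p.2 ≠ x}

end Core
section Eucl

variable {n : ℕ}

/-- The set `A_k = {(i,j) : 1 ≤ i ≤ n, 1 ≤ j ≤ k_i}`; the element `⟨i, j⟩` with
`j : Fin (k i)` represents the pair `(i, j+1)` of the paper. -/
abbrev AkT (k : Fin n → ℕ) := Σ i : Fin n, Fin (k i)

/-- The value `j` of an element `(i,j) ∈ A_k`, as an integer. -/
def jval {k : Fin n → ℕ} (p : AkT k) : ℤ := ((p.2 : ℕ) : ℤ) + 1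

/-- `[a,b]` is an elementary cube: `a ≤ b ≤ a + 1` coordinatewise. -/
def IsElemCube (a b : Fin n → ℤ) : Prop := a ≤ b ∧ ∀ i, b i ≤ a i + 1

/-- The cube `i_k([a,b])` of the standard `A_k`-cube associated to an elementary
cube `[a,b] ⊆ [0,k]`. -/
def ik (k : Fin n → ℕ) (a b : Fin n → ℤ) : Cube (AkT k) := fun p =>
  if b p.1 < jval p then some false
  else if jval p ≤ a p.1 then some true
  else none

/-- `⊞^k`: the `A_k`-cubical complex of images under `i_k` of all elementary cubes
contained in `[0,k]`. -/
def boxK (k : Fin n → ℕ) : Set (Cube (AkT k)) :=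
  {c | ∃ a b : Fin n → ℤ, IsElemCube a b ∧ 0 ≤ a ∧ (∀ i, b i ≤ (k i : ℤ)) ∧
    c = ik k a b}

/-- The multiset `B̄` over `{1,…,n}` associated to `B ⊆ A_k`, as its multiplicity
function: `i` has multiplicity `#{j : (i,j) ∈ B}`. -/
def mulOf {k : Fin n → ℕ} (B : Finset (AkT k)) : Fin n → ℕ := fun i =>
  (B.filter fun p => p.1 = i).card

/-- Sum of the multiplicity functions of a list of multisets over `{1,…,n}`. -/
def sumMul (Lb : List (Fin n → ℕ)) : Fin n → ℕ := fun i =>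
  (Lb.map fun c => c i).sum

/-- An ordered partition of the multiset `[k]`: a sequence of nonempty multisets
over `{1,…,n}` (given by multiplicity functions) summing to `k`. -/
def IsMPart (k : Fin n → ℕ) (Lb : List (Fin n → ℕ)) : Prop :=
  (∀ c ∈ Lb, c ≠ 0) ∧ sumMul Lb = k

/-- A proper ordered partition of `[k]`: all blocks are sets. -/
def IsProperMPart (k : Fin n → ℕ) (Lb : List (Fin n → ℕ)) : Prop :=
  IsMPart k Lb ∧ ∀ c ∈ Lb, ∀ i, c i ≤ 1

end Eucl

theorem mem_blocksUnion {A : Type*} [DecidableEq A] (L : List (Finset A)) (x : A) :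
    x ∈ blocksUnion L ↔ ∃ B ∈ L, x ∈ B := by
  induction L with
  | nil => simp [blocksUnion]
  | cons B L ih =>
    change x ∈ B ∪ blocksUnion L ↔ _
    simp [ih]

theorem disjoint_blocksUnion {A : Type*} [DecidableEq A] {B : Finset A}
    {L : List (Finset A)} (h : ∀ C ∈ L, Disjoint B C) : Disjoint B (blocksUnion L) := by
  rw [Finset.disjoint_left]
  intro x hx hxL
  obtain ⟨C, hC, hxC⟩ := (mem_blocksUnion L x).1 hxL
  exact Finset.disjoint_left.1 (h C hC) hx hxC

theorem mulOf_union {n : ℕ} {k : Fin n → ℕ} {B C : Finset (AkT k)} (h : Disjoint B C)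
    (i : Fin n) : mulOf (B ∪ C) i = mulOf B i + mulOf C i := by
  unfold mulOf
  rw [Finset.filter_union, Finset.card_union_of_disjoint (Finset.disjoint_filter_filter h)]

theorem sumMul_map_mulOf {n : ℕ} {k : Fin n → ℕ} {L : List (Finset (AkT k))}
    (h : L.Pairwise fun B C => Disjoint B C) :
    sumMul (L.map fun B => mulOf B) = mulOf (blocksUnion L) := by
  funext i
  induction L with
  | nil => simp [sumMul, mulOf, blocksUnion]
  | cons B L ih =>
    rw [List.pairwise_cons] at h
    change mulOf B i + sumMul (L.map fun B => mulOf B) i = mulOf (B ∪ blocksUnion L) i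
    rw [ih h.2, mulOf_union (disjoint_blocksUnion h.1)]

theorem mulOf_univ {n : ℕ} (k : Fin n → ℕ) :
    mulOf (Finset.univ : Finset (AkT k)) = k := by
  funext i
  have h : (Finset.univ.filter fun p : AkT k => p.1 = i) =
      Finset.univ.map (Function.Embedding.sigmaMk i) := by
    ext ⟨a, b⟩
    simp only [Finset.mem_filter, Finset.mem_univ, true_and, Finset.mem_map,
      Function.Embedding.sigmaMk_apply]
    constructor
    · rintro rfl
      exact ⟨b, rfl⟩
    · rintro ⟨c, hc⟩
      exact (congrArg Sigma.fst hc).symm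
  rw [mulOf, h, Finset.card_map, Finset.card_univ, Fintype.card_fin]

theorem mulOf_ne_zero {n : ℕ} {k : Fin n → ℕ} {B : Finset (AkT k)} (h : B.Nonempty) :
    mulOf B ≠ 0 := by
  obtain ⟨p, hp⟩ := h
  intro h0
  have hcard : (B.filter fun q => q.1 = p.1).card = 0 := congrFun h0 p.1
  rw [Finset.card_eq_zero] at hcard
  exact Finset.notMem_empty p (hcard ▸ Finset.mem_filter.2 ⟨hp, rfl⟩)

theorem jval_of_ik_eq_none {n : ℕ} {k : Fin n → ℕ} {a b : Fin n → ℤ} (h : IsElemCube a b)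
    {p : AkT k} (hp : ik k a b p = none) : jval p = a p.1 + 1 := by
  have hb := h.2 p.1
  unfold ik at hp
  split_ifs at hp
  omega

theorem mulOf_le_one {n : ℕ} {k : Fin n → ℕ} {O B : Finset (AkT k)}
    (h : cubeOn O B ∈ boxK k) (i : Fin n) : mulOf B i ≤ 1 := by
  obtain ⟨a, b, hab, -, -, hc⟩ := h
  have hj : ∀ p ∈ B, jval p = a p.1 + 1 := fun p hp =>
    jval_of_ik_eq_none hab (by rw [← hc]; simp [cubeOn, hp])
  refine Finset.card_le_one.2 ?_
  rintro ⟨i₁, x⟩ hx ⟨i₂, y⟩ hy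
  simp only [Finset.mem_filter] at hx hy
  obtain ⟨hx, rfl⟩ := hx
  obtain ⟨hy, rfl⟩ := hy
  have hxy := (hj _ hx).trans (hj _ hy).symm
  simp only [jval] at hxy
  congr 1
  ext
  omega

/-- If `λ = B₁|…|B_l ∈ P_{⊞^k}`, then every `B̄_r` is a set, and
`λ̄ = B̄₁|…|B̄_l` is a proper ordered partition of the multiset `[k]`. -/
theorem stmt_15 (n : ℕ) (k : Fin n → ℕ)
    (L : List (Finset (AkT k))) (hL : L ∈ PK (boxK k) ∅ Finset.univ) :
    (∀ (r : ℕ) (hr : r < L.length), ∀ i : Fin n, mulOf (L[r]'hr) i ≤ 1) ∧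
      IsProperMPart k (L.map fun B => mulOf B) := by
  obtain ⟨⟨hne, hdisj, hun⟩, hcube⟩ := hL
  have hle : ∀ (r : ℕ) (hr : r < L.length), ∀ i : Fin n, mulOf (L[r]'hr) i ≤ 1 :=
    fun r hr => mulOf_le_one (hcube r hr)
  refine ⟨hle, ⟨?_, ?_⟩, ?_⟩
  · intro c hc
    obtain ⟨B, hB, rfl⟩ := List.mem_map.1 hc
    exact mulOf_ne_zero (hne B hB)
  · rw [sumMul_map_mulOf hdisj, hun, mulOf_univ]
  · intro c hc
    obtain ⟨B, hB, rfl⟩ := List.mem_map.1 hc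
    obtain ⟨r, hr, rfl⟩ := List.mem_iff_getElem.1 hB
    exact hle r hr
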